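/- arXiv:2410.07372 — 3 statements merged into one kernel-verified Lean document; each statement's English description precedes it below -/
import Mathlib

section
/- Let n be a natural number and let F, H, u : ℝⁿ → ℝ be smooth functions. Then for every x ∈ ℝⁿ, Δ(e^{H}u)(x) − ⟨∇F(x), ∇(e^{H}u)(x)⟩ = e^{H(x)} · ( Δu(x) − ⟨∇F(x) − 2∇H(x), ∇u(x)⟩ + (ΔH(x) + ⟨∇H(x) − ∇F(x), ∇H(x)⟩) · u(x) ). In other words, e^{-H} Δ_F (e^{H} u) = Δ_{F−2H} u + (ΔH + ⟨∇(H−F), ∇H⟩) u (the Euclidean case of the Cheng–Zhou conjugation lemma, Lemma 3.1 of the paper). -/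
open scoped RealInnerProductSpace

/-- The Euclidean Laplacian of `u` at `x`: the sum of the pure second derivatives
in the standard coordinate directions. -/
noncomputable def lap {ι : Type*} [Fintype ι] [DecidableEq ι]
    (u : EuclideanSpace ℝ ι → ℝ) (x : EuclideanSpace ℝ ι) : ℝ :=
  ∑ i, fderiv ℝ (fun y => fderiv ℝ u y (EuclideanSpace.single i 1)) x
    (EuclideanSpace.single i 1)

theorem inner_gradient_eq_sum {ι : Type*} [Fintype ι] [DecidableEq ι]
    (f g : EuclideanSpace ℝ ι → ℝ) (x : EuclideanSpace ℝ ι) :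
    ⟪gradient f x, gradient g x⟫ = ∑ i, fderiv ℝ f x (EuclideanSpace.single i 1) *
      fderiv ℝ g x (EuclideanSpace.single i 1) := by
  rw [← (EuclideanSpace.basisFun ι ℝ).sum_inner_mul_inner]
  simp only [EuclideanSpace.basisFun_apply, inner_gradient_left, inner_gradient_right,
    conj_trivial]

theorem fderiv_exp_mul_apply {E : Type*} [NormedAddCommGroup E] [NormedSpace ℝ E]
    {H u : E → ℝ} {x : E} (hH : DifferentiableAt ℝ H x) (hu : DifferentiableAt ℝ u x) (v : E) :
    fderiv ℝ (fun y => Real.exp (H y) * u y) x v =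
      Real.exp (H x) * (fderiv ℝ u x v + u x * fderiv ℝ H x v) := by
  rw [(hH.hasFDerivAt.exp.fun_mul hu.hasFDerivAt).fderiv]
  simp only [add_apply, smul_apply, smul_eq_mul]
  ring

theorem lap_exp_mul {ι : Type*} [Fintype ι] [DecidableEq ι] {H u : EuclideanSpace ℝ ι → ℝ}
    (hH : ContDiff ℝ 2 H) (hu : ContDiff ℝ 2 u) (x : EuclideanSpace ℝ ι) :
    lap (fun y => Real.exp (H y) * u y) x =
      Real.exp (H x) * (lap u x + 2 * ⟪gradient H x, gradient u x⟫ +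
        (lap H x + ⟪gradient H x, gradient H x⟫) * u x) := by
  have dH : Differentiable ℝ H := hH.differentiable two_ne_zero
  have du : Differentiable ℝ u := hu.differentiable two_ne_zero
  have partial_differentiable {f : EuclideanSpace ℝ ι → ℝ} (hf : ContDiff ℝ 2 f)
      (v : EuclideanSpace ℝ ι) : Differentiable ℝ fun y => fderiv ℝ f y v :=
    ((hf.fderiv_right (m := 1) (by norm_num)).differentiable one_ne_zero).clm_apply
      (differentiable_const v)
  simp only [inner_gradient_eq_sum, lap, Finset.mul_sum, Finset.sum_mul, mul_add, add_mul,
    ← Finset.sum_add_distrib]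
  refine Finset.sum_congr rfl fun i _ => ?_
  set v : EuclideanSpace ℝ ι := EuclideanSpace.single i 1
  have dHv := partial_differentiable hH v x
  have duv := partial_differentiable hu v x
  simp only [fderiv_exp_mul_apply (dH _) (du _)]
  rw [fderiv_exp_mul_apply (dH x) (duv.fun_add ((du x).fun_mul dHv)),
    fderiv_fun_add duv ((du x).fun_mul dHv), fderiv_fun_mul (du x) dHv]
  simp only [add_apply, smul_apply, smul_eq_mul]
  ring

/-- The Euclidean case of the Cheng–Zhou conjugation lemma:
`e^{-H} Δ_F (e^{H} u) = Δ_{F-2H} u + (ΔH + ⟨∇(H-F), ∇H⟩) u`. -/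
theorem cheng_zhou_conjugation {n : ℕ} (F H u : EuclideanSpace ℝ (Fin n) → ℝ)
    (hF : ContDiff ℝ (⊤ : ℕ∞) F) (hH : ContDiff ℝ (⊤ : ℕ∞) H) (hu : ContDiff ℝ (⊤ : ℕ∞) u) :
    ∀ x : EuclideanSpace ℝ (Fin n),
      lap (fun y => Real.exp (H y) * u y) x
        - ⟪gradient F x, gradient (fun y => Real.exp (H y) * u y) x⟫
      = Real.exp (H x) *
          (lap u x - ⟪gradient F x - 2 • gradient H x, gradient u x⟫
            + (lap H x + ⟪gradient H x - gradient F x, gradient H x⟫) * u x) := by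
  intro x
  have dH := hH.differentiable (by simp) x
  have du := hu.differentiable (by simp) x
  rw [lap_exp_mul (contDiff_infty.1 hH 2) (contDiff_infty.1 hu 2)]
  simp only [two_smul, inner_sub_left, inner_add_left]
  simp only [inner_gradient_right, fderiv_exp_mul_apply dH du, conj_trivial]
  ring
end

section
/- Let d be a natural number, a > 0 a real number, and F : ℝᵈ → ℝ a continuously differentiable function with F(x) ≥ 0 and ‖∇F(x)‖² ≤ a·F(x) for all x ∈ ℝᵈ. Then √F is (√a/2)-Lipschitz: for all x, y ∈ ℝᵈ, √(F(x)) ≤ √(F(y)) + (√a/2)·‖x − y‖. Consequently, for any base point x₀, F(x) ≤ (a/4)·( ‖x − x₀‖ + (2/√a)·√(F(x₀)) )² for all x. (This is the gradient-estimate argument giving the upper bound −f(x) ≤ (−ρ/2)(r(x) + c₂)² in Theorem 3.3 of the paper, with a = −2ρ, in the Euclidean case.) -/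
/-- A bound `‖F'‖² ≤ a F` makes every positive shift of `F` have a `√a / 2`-Lipschitz root. -/
theorem norm_sqrt_add_sub_sqrt_add_le {E : Type*} [NormedAddCommGroup E] [NormedSpace ℝ E]
    {F : E → ℝ} {a ε : ℝ} (ha : 0 ≤ a) (hε : 0 < ε) (hF : Differentiable ℝ F)
    (hF0 : ∀ x, 0 ≤ F x) (hbound : ∀ x, ‖fderiv ℝ F x‖ ^ 2 ≤ a * F x) (x y : E) :
    ‖√(F x + ε) - √(F y + ε)‖ ≤ √a / 2 * ‖x - y‖ := by
  have hpos (z : E) : 0 < F z + ε := add_pos_of_nonneg_of_pos (hF0 z) hε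
  refine convex_univ.norm_image_sub_le_of_norm_hasFDerivWithin_le
    (f := fun z => √(F z + ε)) (fun z _ =>
      ((((hF z).hasFDerivAt.add_const ε).sqrt (hpos z).ne').hasFDerivWithinAt))
    (fun z _ => ?_) (Set.mem_univ y) (Set.mem_univ x)
  have hs : 0 < √(F z + ε) := Real.sqrt_pos.2 (hpos z)
  have h : ‖fderiv ℝ F z‖ ≤ √a * √(F z + ε) := by
    rw [← Real.sqrt_mul ha]
    refine Real.le_sqrt_of_sq_le ((hbound z).trans ?_)
    gcongr
    linarith
  rw [norm_smul, Real.norm_of_nonneg (by positivity), one_div_mul_eq_div,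
    div_le_div_iff₀ (by positivity) two_pos]
  linarith

/-- A bound `‖F'‖² ≤ a F` on a nonnegative `F` makes `√F` a `√a / 2`-Lipschitz function. -/
theorem sqrt_le_sqrt_add_of_norm_fderiv_sq_le {E : Type*} [NormedAddCommGroup E] [NormedSpace ℝ E]
    {F : E → ℝ} {a : ℝ} (ha : 0 ≤ a) (hF : Differentiable ℝ F)
    (hF0 : ∀ x, 0 ≤ F x) (hbound : ∀ x, ‖fderiv ℝ F x‖ ^ 2 ≤ a * F x) (x y : E) :
    √(F x) ≤ √(F y) + √a / 2 * ‖x - y‖ := by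
  refine le_of_forall_pos_le_add fun δ hδ => ?_
  have h := (le_abs_self _).trans
    (norm_sqrt_add_sub_sqrt_add_le ha (pow_pos hδ 2) hF hF0 hbound x y)
  have hx : √(F x) ≤ √(F x + δ ^ 2) := Real.sqrt_le_sqrt (by linarith [sq_nonneg δ])
  have hy : √(F y + δ ^ 2) ≤ √(F y) + δ := by
    refine Real.sqrt_le_iff.2 ⟨by positivity, ?_⟩
    nlinarith [Real.sq_sqrt (hF0 y), mul_nonneg (Real.sqrt_nonneg (F y)) hδ.le]
  linarith


/-- The gradient-estimate argument of Theorem 3.3 (Euclidean case): if `F ≥ 0` is `C¹`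
with `‖∇F‖² ≤ a F` for some `a > 0`, then `√F` is `(√a/2)`-Lipschitz, and consequently
`F(x) ≤ (a/4)(‖x - x₀‖ + (2/√a)√(F(x₀)))²` for every base point `x₀`. -/
theorem potential_growth_upper_bound (d : ℕ) (a : ℝ) (ha : 0 < a)
    (F : EuclideanSpace ℝ (Fin d) → ℝ) (hF : ContDiff ℝ 1 F)
    (hF0 : ∀ x, 0 ≤ F x) (hgrad : ∀ x, ‖gradient F x‖ ^ 2 ≤ a * F x) :
    (∀ x y : EuclideanSpace ℝ (Fin d),
      Real.sqrt (F x) ≤ Real.sqrt (F y) + (Real.sqrt a / 2) * ‖x - y‖) ∧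
    (∀ x₀ x : EuclideanSpace ℝ (Fin d),
      F x ≤ (a / 4) * (‖x - x₀‖ + (2 / Real.sqrt a) * Real.sqrt (F x₀)) ^ 2) := by
  have hlip (x y : EuclideanSpace ℝ (Fin d)) : √(F x) ≤ √(F y) + √a / 2 * ‖x - y‖ := by
    refine sqrt_le_sqrt_add_of_norm_fderiv_sq_le ha.le (hF.differentiable one_ne_zero) hF0
      (fun z => ?_) x y
    simpa only [gradient, LinearIsometryEquiv.norm_map] using hgrad z
  refine ⟨hlip, fun x₀ x => ?_⟩
  have hsa : 0 < √a := Real.sqrt_pos.2 ha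
  calc F x = √(F x) ^ 2 := (Real.sq_sqrt (hF0 x)).symm
    _ ≤ (√(F x₀) + √a / 2 * ‖x - x₀‖) ^ 2 := by gcongr; exact hlip x x₀
    _ = √a ^ 2 / 4 * (‖x - x₀‖ + 2 / √a * √(F x₀)) ^ 2 := by field_simp; ring
    _ = a / 4 * (‖x - x₀‖ + 2 / √a * √(F x₀)) ^ 2 := by rw [Real.sq_sqrt ha.le]
end

section
/- Let ρ < 0 be a real number and m a natural number. Then for every smooth compactly supported function u : ℝᵐ → ℝ, ∫_{ℝᵐ} ‖∇u(y)‖² e^{−(ρ/2)‖y‖²} dy ≥ (−ρ)·m · ∫_{ℝᵐ} u(y)² e^{−(ρ/2)‖y‖²} dy. (This weighted Poincaré-type inequality expresses that the first eigenvalue of the drift Laplacian of the Gaussian expander (ℝᵐ, f(y) = (ρ/2)‖y‖²) equals −ρm, as asserted in Theorems 1.4 and 5.4 of the paper for the Euclidean factor.) -/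
open MeasureTheory

/-- The integral of a directional derivative of a compactly supported `C¹` function vanishes. -/
lemma integral_fderiv_apply_eq_zero {E : Type*} [NormedAddCommGroup E] [NormedSpace ℝ E]
    [FiniteDimensional ℝ E] [MeasurableSpace E] [BorelSpace E] (μ : Measure E)
    [μ.IsAddHaarMeasure] {g : E → ℝ} (hg : ContDiff ℝ 1 g) (hcg : HasCompactSupport g) (v : E) :
    ∫ x, fderiv ℝ g x v ∂μ = 0 := by
  have hint : Integrable (fun x ↦ fderiv ℝ g x v) μ :=
    ((hg.continuous_fderiv one_ne_zero).clm_apply continuous_const).integrable_of_hasCompactSupport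
      (hcg.fderiv_apply ℝ v)
  have h := integral_mul_fderiv_eq_neg_fderiv_mul_of_integrable (𝕜 := ℝ) (μ := μ)
    (f := fun _ ↦ 1) (g := g) (v := v) (by simp) (by simpa using hint)
    (by simpa using hg.continuous.integrable_of_hasCompactSupport hcg)
    (fun x _ ↦ differentiableAt_const _) (fun x _ ↦ hg.differentiable one_ne_zero x)
  simpa using h

/-- The derivative of a Gaussian weight. -/
lemma hasFDerivAt_exp_neg_mul_norm_sq {E : Type*} [NormedAddCommGroup E]
    [InnerProductSpace ℝ E] (c : ℝ) (y : E) :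
    HasFDerivAt (fun y : E ↦ Real.exp (-(c * ‖y‖ ^ 2)))
      ((-(2 * c) * Real.exp (-(c * ‖y‖ ^ 2))) • innerSL ℝ y) y := by
  have h := (((hasStrictFDerivAt_norm_sq y).hasFDerivAt.const_mul c).neg).exp
  refine h.congr_fderiv ?_
  ext x
  simp
  ring

/-- The weighted Poincaré inequality in the direction of a unit vector, for a nonnegative weight `w`
with `∇w = -ρ w y`. -/
lemma integral_sq_mul_le_integral_fderiv_sq_mul {E : Type*} [NormedAddCommGroup E]
    [InnerProductSpace ℝ E] [FiniteDimensional ℝ E] [MeasurableSpace E] [BorelSpace E]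
    (μ : Measure E) [μ.IsAddHaarMeasure] (ρ : ℝ) {w : E → ℝ} (hwc : ContDiff ℝ 1 w)
    (hw : ∀ y, 0 ≤ w y) (hwd : ∀ y, HasFDerivAt w ((-ρ * w y) • innerSL ℝ y) y)
    {u : E → ℝ} (hu : ContDiff ℝ 1 u) (hcu : HasCompactSupport u) {v : E} (hv : ‖v‖ = 1) :
    -ρ * ∫ y, u y ^ 2 * w y ∂μ ≤ ∫ y, fderiv ℝ u y v ^ 2 * w y ∂μ := by
  let g : E → ℝ := fun y ↦ inner ℝ v y * (u y ^ 2 * w y)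
  have hgc : ContDiff ℝ 1 g :=
    (innerSL ℝ v).contDiff.mul ((hu.pow 2).mul hwc)
  have hu2 : HasCompactSupport fun y ↦ u y ^ 2 * w y :=
    (hcu.comp_left (g := fun t : ℝ ↦ t ^ 2) (by simp)).mul_right
  have hcg : HasCompactSupport g := hu2.mul_left
  have hdu : Continuous fun y ↦ fderiv ℝ u y v :=
    (hu.continuous_fderiv one_ne_zero).clm_apply continuous_const
  have hu_int : Integrable (fun y ↦ u y ^ 2 * w y) μ :=
    ((hu.continuous.pow 2).mul hwc.continuous).integrable_of_hasCompactSupport hu2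
  have hdu2 : HasCompactSupport fun y ↦ fderiv ℝ u y v ^ 2 * w y :=
    ((hcu.fderiv_apply ℝ v).comp_left (g := fun t : ℝ ↦ t ^ 2) (by simp)).mul_right
  have hdu_int : Integrable (fun y ↦ fderiv ℝ u y v ^ 2 * w y) μ :=
    ((hdu.pow 2).mul hwc.continuous).integrable_of_hasCompactSupport hdu2
  have hdg_int : Integrable (fun y ↦ fderiv ℝ g y v) μ :=
    ((hgc.continuous_fderiv one_ne_zero).clm_apply
      continuous_const).integrable_of_hasCompactSupport (hcg.fderiv_apply ℝ v)
  have hdg (y : E) : fderiv ℝ g y v = u y ^ 2 * w y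
      + inner ℝ v y * (2 * u y * fderiv ℝ u y v - ρ * inner ℝ v y * u y ^ 2) * w y := by
    have h : HasFDerivAt g _ y := ((innerSL ℝ v).hasFDerivAt (x := y)).mul
      (((hu.differentiable one_ne_zero y).hasFDerivAt.pow 2).mul (hwd y))
    rw [h.fderiv]
    simp [hv, real_inner_comm v y]
    ring
  have key : 0 ≤ ∫ y, (fderiv ℝ u y v ^ 2 * w y - -ρ * (u y ^ 2 * w y))
      + -ρ * fderiv ℝ g y v ∂μ := by
    refine integral_nonneg fun y ↦ ?_
    have hsq : 0 ≤ (fderiv ℝ u y v - ρ * inner ℝ v y * u y) ^ 2 * w y :=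
      mul_nonneg (sq_nonneg _) (hw y)
    simp only [Pi.zero_apply, hdg]
    linear_combination hsq
  have hsub_int : Integrable (fun y ↦ fderiv ℝ u y v ^ 2 * w y - -ρ * (u y ^ 2 * w y)) μ :=
    hdu_int.sub (hu_int.const_mul _)
  rw [integral_add hsub_int (hdg_int.const_mul _),
    integral_sub hdu_int (hu_int.const_mul _), integral_const_mul, integral_const_mul,
    integral_fderiv_apply_eq_zero μ hgc hcg v] at key
  linarith

/-- The weighted Poincaré-type inequality expressing that the first eigenvalue of the
drift Laplacian of the Gaussian expander `(ℝᵐ, f(y) = (ρ/2)‖y‖²)`, `ρ < 0`,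
equals `-ρ m`: for all smooth compactly supported `u`,
`∫ ‖∇u‖² e^{-f} ≥ (-ρ) m ∫ u² e^{-f}`. -/
theorem gaussian_expander_poincare (ρ : ℝ) (hρ : ρ < 0) (m : ℕ)
    (u : EuclideanSpace ℝ (Fin m) → ℝ) (hu : ContDiff ℝ (⊤ : ℕ∞) u)
    (hcu : HasCompactSupport u) :
    ∫ y, ‖gradient u y‖ ^ 2 * Real.exp (-(ρ / 2 * ‖y‖ ^ 2))
      ≥ (-ρ) * m * ∫ y, (u y) ^ 2 * Real.exp (-(ρ / 2 * ‖y‖ ^ 2)) := by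
  have hu1 : ContDiff ℝ 1 u := hu.of_le (by exact_mod_cast le_top)
  have hwc : ContDiff ℝ 1 fun y : EuclideanSpace ℝ (Fin m) ↦
      Real.exp (-(ρ / 2 * ‖y‖ ^ 2)) := by
    have := contDiff_norm_sq ℝ (E := EuclideanSpace ℝ (Fin m)) (n := 1)
    fun_prop
  have hwd (y : EuclideanSpace ℝ (Fin m)) := hasFDerivAt_exp_neg_mul_norm_sq (ρ / 2) y
  simp_rw [mul_div_cancel₀ ρ two_ne_zero] at hwd
  set b := EuclideanSpace.basisFun (Fin m) ℝ
  have hgrad (y : EuclideanSpace ℝ (Fin m)) :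
      ‖gradient u y‖ ^ 2 = ∑ i, fderiv ℝ u y (b i) ^ 2 := by
    rw [← b.sum_sq_norm_inner_left]
    refine Finset.sum_congr rfl fun i _ ↦ ?_
    rw [gradient, InnerProductSpace.toDual_symm_apply, Real.norm_eq_abs, sq_abs]
  have hint (i : Fin m) : Integrable fun y ↦
      fderiv ℝ u y (b i) ^ 2 * Real.exp (-(ρ / 2 * ‖y‖ ^ 2)) := by
    have := (hu1.continuous_fderiv one_ne_zero).clm_apply (continuous_const (y := b i))
    exact Continuous.integrable_of_hasCompactSupport (by fun_prop)
      ((hcu.fderiv_apply ℝ (b i)).comp_left (g := fun t : ℝ ↦ t ^ 2) (by simp)).mul_right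
  simp_rw [hgrad, Finset.sum_mul]
  rw [integral_finsetSum _ fun i _ ↦ hint i]
  have h := Finset.sum_le_sum fun (i : Fin m) (_ : i ∈ Finset.univ) ↦
    integral_sq_mul_le_integral_fderiv_sq_mul volume ρ hwc (fun _ ↦ (Real.exp_pos _).le) hwd
      hu1 hcu (b.norm_eq_one i)
  rw [Finset.sum_const, Finset.card_univ, Fintype.card_fin, nsmul_eq_mul] at h
  linarith
end
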